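/- arXiv:2204.05359 — 3 statements merged into one kernel-verified Lean document; each statement's English description precedes it below -/
import Mathlib

section
/- For every nonnegative matrix M ∈ ℝ^{n×n}, ν̄(M) ≤ n·ν_C(M); combined with ν_C(M) ≤ ν̄(M), this gives 1 ≤ ν̄(M)/ν_C(M) ≤ n whenever ν_C(M) > 0. -/
open Matrix BigOperators

/-- `ν_C(M)`: the reciprocal of the minimal trace of a nonnegative diagonal
perturbation `Δ` making `I - Δ M` singular (`ν_C(M) = 0` if no such `Δ` exists). -/
noncomputable def nuC {n : ℕ} (M : Matrix (Fin n) (Fin n) ℝ) : ℝ :=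
  (sInf {s : ℝ | ∃ δ : Fin n → ℝ, (∀ i, 0 ≤ δ i) ∧
      (1 - Matrix.diagonal δ * M).det = 0 ∧ s = ∑ i, δ i})⁻¹

/-- `ν̄(M) = inf { max_{i,j} M_ij d_i / d_j : d ∈ ℝ^n, d_i > 0 }`. -/
noncomputable def nuBar {n : ℕ} (M : Matrix (Fin n) (Fin n) ℝ) : ℝ :=
  sInf {v : ℝ | ∃ d : Fin n → ℝ, (∀ i, 0 < d i) ∧ v = ⨆ i, ⨆ j, M i j * d i / d j}

/-- If `s x = M x + 1` with `M` nonnegative and `s` above all row sums, then `x` is positive. -/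
lemma pos_of_rowSum_lt {n : ℕ} {M : Matrix (Fin n) (Fin n) ℝ} (hM : ∀ i j, 0 ≤ M i j)
    {s : ℝ} (hs : ∀ i, ∑ j, M i j < s) {x : Fin n → ℝ}
    (hx : ∀ i, s * x i = (M *ᵥ x) i + 1) (i : Fin n) : 0 < x i := by
  obtain ⟨k, -, hk⟩ := Finset.exists_min_image Finset.univ x ⟨i, Finset.mem_univ i⟩
  have h1 : (∑ j, M k j) * x k ≤ (M *ᵥ x) k := by
    rw [Finset.sum_mul]
    exact Finset.sum_le_sum fun j _ => mul_le_mul_of_nonneg_left (hk j (Finset.mem_univ j)) (hM k j)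
  have h2 : 0 < x k := by
    have := hx k
    have h3 := hs k
    by_contra! h
    nlinarith
  exact h2.trans_le (hk i (Finset.mem_univ i))

/-- A nonnegative matrix without real eigenvalues in `[t, ∞)` has a positive vector `x` with
`M x ≤ t x`. -/
lemma exists_pos_mulVec_le {n : ℕ} {M : Matrix (Fin n) (Fin n) ℝ} (hM : ∀ i j, 0 ≤ M i j)
    {t : ℝ} (ht : 0 < t) (hdet : ∀ s, t ≤ s → (s • (1 : Matrix (Fin n) (Fin n) ℝ) - M).det ≠ 0) :
    ∃ x : Fin n → ℝ, (∀ i, 0 < x i) ∧ ∀ i, (M *ᵥ x) i ≤ t * x i := by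
  let A : Set.Ici t → Matrix (Fin n) (Fin n) ℝ := fun s => (s : ℝ) • 1 - M
  let x : Set.Ici t → Fin n → ℝ := fun s => (A s).det⁻¹ • ((A s).adjugate *ᵥ 1)
  have hA : Continuous A := by fun_prop
  have hxc : Continuous x :=
    (hA.matrix_det.inv₀ fun s => hdet s s.2).smul (hA.matrix_adjugate.matrix_mulVec continuous_const)
  have hx : ∀ (s : Set.Ici t) (i), (s : ℝ) * x s i = (M *ᵥ x s) i + 1 := by
    intro s i
    have h : A s *ᵥ x s = 1 := by
      simp only [x]
      rw [mulVec_smul, mulVec_mulVec, mul_adjugate, smul_mulVec, one_mulVec, smul_smul,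
        inv_mul_cancel₀ (hdet s s.2), one_smul]
    have h' := congrFun h i
    simp only [A, sub_mulVec, smul_mulVec, one_mulVec, Pi.sub_apply, Pi.smul_apply, smul_eq_mul,
      Pi.one_apply] at h'
    linarith
  have hpos : ∀ s : Set.Ici t, (∀ i, 0 ≤ x s i) → ∀ i, 0 < x s i := by
    intro s h i
    have h1 : 0 ≤ ∑ j, M i j * x s j := Finset.sum_nonneg fun j _ => mul_nonneg (hM i j) (h j)
    have h2 : (s : ℝ) * x s i = ∑ j, M i j * x s j + 1 := hx s i
    exact pos_of_mul_pos_right (by linarith) (ht.trans_le s.2).le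
  have hclopen : IsClopen {s | ∀ i, 0 < x s i} := by
    constructor
    · have : {s | ∀ i, 0 < x s i} = {s | ∀ i, 0 ≤ x s i} :=
        Set.ext fun s => ⟨fun h i => (h i).le, hpos s⟩
      rw [this, Set.ofPred_forall]
      exact isClosed_iInter fun i => isClosed_le continuous_const ((continuous_apply i).comp hxc)
    · rw [Set.ofPred_forall]
      exact isOpen_iInter_of_finite fun i =>
        isOpen_lt continuous_const ((continuous_apply i).comp hxc)
  have : PreconnectedSpace (Set.Ici t) := Subtype.preconnectedSpace isPreconnected_Ici
  have huniv : {s | ∀ i, 0 < x s i} = Set.univ := by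
    refine hclopen.eq_univ ?_
    have hsum : 0 ≤ ∑ i, ∑ j, M i j :=
      Finset.sum_nonneg fun i _ => Finset.sum_nonneg fun j _ => hM i j
    refine ⟨⟨t + ∑ i, ∑ j, M i j, le_add_of_nonneg_right hsum⟩,
      pos_of_rowSum_lt hM (fun i => ?_) (hx _)⟩
    have := Finset.single_le_sum (f := fun i => ∑ j, M i j)
      (fun i _ => Finset.sum_nonneg fun j _ => hM i j) (Finset.mem_univ i)
    simp only at this ⊢
    linarith
  have ht' : (⟨t, Set.self_mem_Ici⟩ : Set.Ici t) ∈ {s | ∀ i, 0 < x s i} := huniv ▸ Set.mem_univ _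
  refine ⟨_, ht', fun i => ?_⟩
  have := hx ⟨t, Set.self_mem_Ici⟩ i
  simp only at this
  linarith

lemma le_iSup_scaled {n : ℕ} (M : Matrix (Fin n) (Fin n) ℝ) (d : Fin n → ℝ) (i j : Fin n) :
    M i j * d i / d j ≤ ⨆ i, ⨆ j, M i j * d i / d j :=
  (le_ciSup (f := fun j => M i j * d i / d j) (Set.finite_range _).bddAbove j).trans
    (le_ciSup (f := fun i => ⨆ j, M i j * d i / d j) (Set.finite_range _).bddAbove i)

lemma iSup_scaled_nonneg {n : ℕ} {M : Matrix (Fin n) (Fin n) ℝ} (hM : ∀ i j, 0 ≤ M i j)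
    {d : Fin n → ℝ} (hd : ∀ i, 0 < d i) : 0 ≤ ⨆ i, ⨆ j, M i j * d i / d j :=
  Real.iSup_nonneg fun i => Real.iSup_nonneg fun j =>
    div_nonneg (mul_nonneg (hM i j) (hd i).le) (hd j).le

lemma nuBar_le_iSup {n : ℕ} {M : Matrix (Fin n) (Fin n) ℝ} (hM : ∀ i j, 0 ≤ M i j)
    {d : Fin n → ℝ} (hd : ∀ i, 0 < d i) : nuBar M ≤ ⨆ i, ⨆ j, M i j * d i / d j := by
  refine csInf_le ⟨0, ?_⟩ ⟨d, hd, rfl⟩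
  rintro v ⟨e, he, rfl⟩
  exact iSup_scaled_nonneg hM he

lemma nuBar_le_of_mulVec_le {n : ℕ} {M : Matrix (Fin n) (Fin n) ℝ} (hM : ∀ i j, 0 ≤ M i j)
    {t : ℝ} (ht : 0 ≤ t) {x : Fin n → ℝ} (hx : ∀ i, 0 < x i)
    (h : ∀ i, (M *ᵥ x) i ≤ t * x i) : nuBar M ≤ t := by
  refine (nuBar_le_iSup hM (d := fun i => (x i)⁻¹) fun i => inv_pos.2 (hx i)).trans ?_
  refine Real.iSup_le (fun i => Real.iSup_le (fun j => ?_) ht) ht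
  have h1 : M i j * x j ≤ (M *ᵥ x) i :=
    Finset.single_le_sum (f := fun j => M i j * x j)
      (fun j _ => mul_nonneg (hM i j) (hx j).le) (Finset.mem_univ j)
  have h2 : M i j * (x i)⁻¹ / (x j)⁻¹ = M i j * x j / x i := by
    have := (hx i).ne'
    have := (hx j).ne'
    field_simp
  rw [h2, div_le_iff₀ (hx i)]
  exact h1.trans (h i)

/-- A nonnegative diagonal perturbation making `I - Δ M` singular has trace at least `1 / v`,
where `v` is the largest entry of any diagonal scaling of `M`. -/
lemma one_le_iSup_mul_sum {n : ℕ} {M : Matrix (Fin n) (Fin n) ℝ} (hM : ∀ i j, 0 ≤ M i j)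
    {d : Fin n → ℝ} (hd : ∀ i, 0 < d i) {δ : Fin n → ℝ} (hδ : ∀ i, 0 ≤ δ i)
    (hdet : (1 - Matrix.diagonal δ * M).det = 0) :
    1 ≤ (⨆ i, ⨆ j, M i j * d i / d j) * ∑ i, δ i := by
  obtain ⟨y, hy0, hy⟩ := Matrix.exists_mulVec_eq_zero_iff.2 hdet
  set v := ⨆ i, ⨆ j, M i j * d i / d j
  have hyi : ∀ i, y i = δ i * ∑ j, M i j * y j := by
    intro i
    have h := congrFun hy i
    rw [sub_mulVec, one_mulVec, ← mulVec_mulVec] at h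
    simp only [Pi.sub_apply, mulVec_diagonal, Pi.zero_apply] at h
    exact sub_eq_zero.1 h
  set T := ∑ j, d j * |y j|
  have hbound : ∀ i, d i * |y i| ≤ δ i * (v * T) := by
    intro i
    have h1 : |∑ j, M i j * y j| ≤ ∑ j, M i j * |y j| :=
      (Finset.abs_sum_le_sum_abs _ _).trans_eq <|
        Finset.sum_congr rfl fun j _ => by rw [abs_mul, abs_of_nonneg (hM i j)]
    have h2 : d i * ∑ j, M i j * |y j| ≤ v * T := by
      rw [Finset.mul_sum, Finset.mul_sum]
      refine Finset.sum_le_sum fun j _ => ?_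
      have h3 := (div_le_iff₀ (hd j)).1 (le_iSup_scaled M d i j)
      calc d i * (M i j * |y j|) = M i j * d i * |y j| := by ring
        _ ≤ v * d j * |y j| := mul_le_mul_of_nonneg_right h3 (abs_nonneg _)
        _ = v * (d j * |y j|) := by ring
    calc d i * |y i| = δ i * (d i * |∑ j, M i j * y j|) := by
          rw [hyi i, abs_mul, abs_of_nonneg (hδ i)]; ring
      _ ≤ δ i * (v * T) := mul_le_mul_of_nonneg_left
          ((mul_le_mul_of_nonneg_left h1 (hd i).le).trans h2) (hδ i)
  have hT : 0 < T := by
    obtain ⟨k, hk⟩ := Function.ne_iff.1 hy0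
    exact Finset.sum_pos' (fun j _ => mul_nonneg (hd j).le (abs_nonneg _))
      ⟨k, Finset.mem_univ k, mul_pos (hd k) (abs_pos.2 hk)⟩
  have hTle : T ≤ (∑ i, δ i) * (v * T) := by
    rw [Finset.sum_mul]
    exact Finset.sum_le_sum fun i _ => hbound i
  refine le_of_mul_le_mul_right ?_ hT
  linarith

lemma nuC_nonneg {n : ℕ} (M : Matrix (Fin n) (Fin n) ℝ) : 0 ≤ nuC M := by
  refine inv_nonneg.2 (Real.sInf_nonneg ?_)
  rintro s ⟨δ, hδ, -, rfl⟩
  exact Finset.sum_nonneg fun i _ => hδ i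

lemma nuC_le_iSup {n : ℕ} {M : Matrix (Fin n) (Fin n) ℝ} (hM : ∀ i j, 0 ≤ M i j)
    {d : Fin n → ℝ} (hd : ∀ i, 0 < d i) : nuC M ≤ ⨆ i, ⨆ j, M i j * d i / d j := by
  have hv := iSup_scaled_nonneg hM hd
  rcases hv.eq_or_lt with hv0 | hvpos
  · have hS : {s : ℝ | ∃ δ : Fin n → ℝ, (∀ i, 0 ≤ δ i) ∧
        (1 - Matrix.diagonal δ * M).det = 0 ∧ s = ∑ i, δ i} = ∅ := by
      refine Set.eq_empty_of_forall_notMem ?_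
      rintro s ⟨δ, hδ, hdet, -⟩
      have := one_le_iSup_mul_sum hM hd hδ hdet
      rw [← hv0] at this
      linarith
    rw [nuC, hS, Real.sInf_empty, _root_.inv_zero]
    exact hv
  · rcases Set.eq_empty_or_nonempty {s : ℝ | ∃ δ : Fin n → ℝ, (∀ i, 0 ≤ δ i) ∧
        (1 - Matrix.diagonal δ * M).det = 0 ∧ s = ∑ i, δ i} with hS | hS
    · rw [nuC, hS, Real.sInf_empty, _root_.inv_zero]
      exact hv
    · refine inv_le_of_inv_le₀ hvpos (le_csInf hS ?_)
      rintro s ⟨δ, hδ, hdet, rfl⟩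
      rw [inv_le_iff_one_le_mul₀' hvpos]
      exact one_le_iSup_mul_sum hM hd hδ hdet

lemma nuC_le_nuBar {n : ℕ} {M : Matrix (Fin n) (Fin n) ℝ} (hM : ∀ i j, 0 ≤ M i j) :
    nuC M ≤ nuBar M := by
  refine le_csInf ⟨_, fun _ => 1, fun _ => one_pos, rfl⟩ ?_
  rintro v ⟨d, hd, rfl⟩
  exact nuC_le_iSup hM hd

lemma inv_sum_le_nuC {n : ℕ} {M : Matrix (Fin n) (Fin n) ℝ} (hM : ∀ i j, 0 ≤ M i j)
    {δ : Fin n → ℝ} (hδ : ∀ i, 0 ≤ δ i) (hdet : (1 - Matrix.diagonal δ * M).det = 0) :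
    (∑ i, δ i)⁻¹ ≤ nuC M := by
  have hone : ∀ i : Fin n, (0 : ℝ) < (fun _ => 1 : Fin n → ℝ) i := fun _ => one_pos
  have hv : 0 < ⨆ i, ⨆ j, M i j * (fun _ => 1 : Fin n → ℝ) i / (fun _ => 1 : Fin n → ℝ) j := by
    refine (iSup_scaled_nonneg hM hone).lt_of_ne fun h => ?_
    have := one_le_iSup_mul_sum hM hone hδ hdet
    rw [← h] at this
    linarith
  refine inv_anti₀ ((inv_pos.2 hv).trans_le (le_csInf ⟨_, δ, hδ, hdet, rfl⟩ ?_))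
    (csInf_le ⟨0, ?_⟩ ⟨δ, hδ, hdet, rfl⟩)
  · rintro s ⟨ε, hε, hdetε, rfl⟩
    rw [inv_le_iff_one_le_mul₀' hv]
    exact one_le_iSup_mul_sum hM hone hε hdetε
  · rintro s ⟨ε, hε, -, rfl⟩
    exact Finset.sum_nonneg fun i _ => hε i

/-- Every positive real eigenvalue of `M` is at most `n · ν_C(M)`. -/
lemma le_mul_nuC_of_det_eq_zero {n : ℕ} (hn : 1 ≤ n) {M : Matrix (Fin n) (Fin n) ℝ}
    (hM : ∀ i j, 0 ≤ M i j) {s : ℝ} (hs : 0 < s)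
    (hdet : (s • (1 : Matrix (Fin n) (Fin n) ℝ) - M).det = 0) : s ≤ n * nuC M := by
  have hdet' : (1 - Matrix.diagonal (fun _ : Fin n => s⁻¹) * M).det = 0 := by
    have : 1 - Matrix.diagonal (fun _ : Fin n => s⁻¹) * M = s⁻¹ • (s • 1 - M) := by
      rw [← smul_one_eq_diagonal, smul_mul, one_mul, smul_sub, smul_smul,
        inv_mul_cancel₀ hs.ne', one_smul]
    rw [this, det_smul, hdet, mul_zero]
  have h := inv_sum_le_nuC hM (fun _ => (inv_pos.2 hs).le) hdet'
  have hn' : (0 : ℝ) < n := by exact_mod_cast hn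
  rw [Finset.sum_const, Finset.card_univ, Fintype.card_fin, nsmul_eq_mul, mul_inv, inv_inv,
    inv_mul_le_iff₀ hn'] at h
  exact h

/-- For every nonnegative matrix `M`, `ν̄(M) ≤ n · ν_C(M)`; combined with
`ν_C(M) ≤ ν̄(M)`, this gives `1 ≤ ν̄(M)/ν_C(M) ≤ n` whenever `ν_C(M) > 0`. -/
theorem nuBar_le_n_mul_nuC {n : ℕ} (hn : 1 ≤ n) (M : Matrix (Fin n) (Fin n) ℝ)
    (hM : ∀ i j, 0 ≤ M i j) :
    nuBar M ≤ n * nuC M ∧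
      (0 < nuC M → 1 ≤ nuBar M / nuC M ∧ nuBar M / nuC M ≤ n) := by
  have h : nuBar M ≤ n * nuC M := by
    refine le_of_forall_gt_imp_ge_of_dense fun t ht => ?_
    have htpos : 0 < t := (mul_nonneg n.cast_nonneg (nuC_nonneg M)).trans_lt ht
    obtain ⟨x, hx, hMx⟩ := exists_pos_mulVec_le hM htpos fun s hs hdet =>
      (ht.trans_le hs).not_ge (le_mul_nuC_of_det_eq_zero hn hM (htpos.trans_le hs) hdet)
    exact nuBar_le_of_mulVec_le hM htpos.le hx hMx
  exact ⟨h, fun hpos => ⟨(one_le_div hpos).2 (nuC_le_nuBar hM), (div_le_iff₀ hpos).2 h⟩⟩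
end

section
/- Let C ∈ ℝ^{n×n} be the pure ring (cyclic) matrix with C_{i,i+1} = 1 for i = 1,…,n−1, C_{n,1} = 1, and all other entries 0. Then ν_C(C) = 1/n and ν̄(C) = 1, so the pure ring achieves the worst-case ratio ν̄/ν_C = n. -/
open Matrix BigOperators

/-- The pure ring (cyclic shift) matrix: `C_{i,i+1} = 1` (indices mod `n`, so in
particular `C_{n,1} = 1`) and all other entries `0`. -/
def ringMatrix (n : ℕ) [NeZero n] : Matrix (Fin n) (Fin n) ℝ :=
  fun i j => if j = i + 1 then 1 else 0

theorem ringMatrix_mulVec {n : ℕ} [NeZero n] (v : Fin n → ℝ) (i : Fin n) :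
    (ringMatrix n *ᵥ v) i = v (i + 1) := by
  simp [ringMatrix, Matrix.mulVec, dotProduct]

open Fin.CommRing in
/-- A predicate on `Fin n` closed under the cyclic successor holds everywhere once it holds
somewhere. -/
theorem forall_of_cyclic_succ {n : ℕ} [NeZero n] {p : Fin n → Prop}
    (hp : ∀ i, p i → p (i + 1)) {i : Fin n} (hi : p i) (j : Fin n) : p j := by
  have key : ∀ m : ℕ, p (i + (m : Fin n)) := by
    intro m
    induction m with
    | zero => simpa using hi
    | succ m ih =>
      rw [Nat.cast_succ, ← add_assoc]
      exact hp _ ih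
  have h := key (j - i).val
  rwa [Fin.cast_val_eq_self, add_sub_cancel] at h

theorem prod_eq_one_of_det_eq_zero {n : ℕ} [NeZero n] {δ : Fin n → ℝ}
    (h : (1 - Matrix.diagonal δ * ringMatrix n).det = 0) : ∏ i, δ i = 1 := by
  obtain ⟨v, hv, hv0⟩ := Matrix.exists_mulVec_eq_zero_iff.mpr h
  have hrec (i : Fin n) : v i = δ i * v (i + 1) := by
    have := congrFun hv0 i
    rw [Matrix.sub_mulVec, Matrix.one_mulVec, ← Matrix.mulVec_mulVec, Pi.sub_apply,
      Matrix.mulVec_diagonal, ringMatrix_mulVec, Pi.zero_apply] at this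
    linarith
  obtain ⟨i, hi⟩ := Function.ne_iff.mp hv
  have hne (j : Fin n) : v j ≠ 0 :=
    forall_of_cyclic_succ (p := fun j => v j ≠ 0)
      (fun j hj hj1 => hj (by rw [hrec, hj1, mul_zero])) hi j
  have hprod : ∏ j, v j = (∏ j, δ j) * ∏ j, v j := by
    conv_lhs => rw [Finset.prod_congr rfl fun j _ => hrec j, Finset.prod_mul_distrib]
    rw [Equiv.prod_comp (Equiv.addRight (1 : Fin n)) v |>.symm]
    rfl
  exact mul_right_cancel₀ (Finset.prod_ne_zero_iff.mpr fun j _ => hne j)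
    (by rw [one_mul]; exact hprod.symm)

theorem card_le_sum_of_prod_eq_one {ι : Type*} [Fintype ι] {δ : ι → ℝ}
    (hδ : ∀ i, 0 ≤ δ i) (h : ∏ i, δ i = 1) : (Fintype.card ι : ℝ) ≤ ∑ i, δ i := by
  have hne (i : ι) : δ i ≠ 0 :=
    Finset.prod_ne_zero_iff.mp (h ▸ one_ne_zero) i (Finset.mem_univ i)
  have hlog : ∑ i, Real.log (δ i) = 0 := by
    rw [← Real.log_prod fun i _ => hne i, h, Real.log_one]
  have hle : ∑ i, Real.log (δ i) ≤ ∑ i, (δ i - 1) :=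
    Finset.sum_le_sum fun i _ => Real.log_le_sub_one_of_pos ((hδ i).lt_of_ne' (hne i))
  simp only [Finset.sum_sub_distrib, Finset.sum_const, Finset.card_univ, nsmul_eq_mul,
    mul_one] at hle
  linarith

theorem nuC_ringMatrix (n : ℕ) [NeZero n] : nuC (ringMatrix n) = 1 / n := by
  rw [nuC, one_div]
  congr 1
  refine IsLeast.csInf_eq ⟨⟨fun _ => 1, fun _ => zero_le_one, ?_, by simp⟩, ?_⟩
  · refine Matrix.exists_mulVec_eq_zero_iff.mp ⟨fun _ => 1, ?_, ?_⟩
    · exact Function.ne_iff.mpr ⟨0, one_ne_zero⟩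
    · ext i
      rw [Matrix.sub_mulVec, Matrix.one_mulVec, ← Matrix.mulVec_mulVec, Pi.sub_apply,
        Matrix.mulVec_diagonal, ringMatrix_mulVec]
      simp
  · rintro s ⟨δ, hδ, hdet, rfl⟩
    simpa using card_le_sum_of_prod_eq_one hδ (prod_eq_one_of_det_eq_zero hdet)

theorem le_iSup_iSup_of_finite {ι κ : Type*} [Finite ι] [Finite κ] (f : ι → κ → ℝ)
    (i : ι) (j : κ) : f i j ≤ ⨆ i, ⨆ j, f i j :=
  (le_ciSup (Set.finite_range (f i)).bddAbove j).trans
    (le_ciSup (f := fun i => ⨆ j, f i j) (Set.finite_range _).bddAbove i)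

theorem one_le_iSup_ringMatrix {n : ℕ} [NeZero n] {d : Fin n → ℝ} (hd : ∀ i, 0 < d i) :
    1 ≤ ⨆ i, ⨆ j, ringMatrix n i j * d i / d j := by
  obtain ⟨i, hi⟩ := Finite.exists_max d
  refine le_trans ?_ (le_iSup_iSup_of_finite (fun i j => ringMatrix n i j * d i / d j) i (i + 1))
  simpa [ringMatrix, one_le_div (hd _)] using hi (i + 1)

theorem nuBar_ringMatrix (n : ℕ) [NeZero n] : nuBar (ringMatrix n) = 1 := by
  refine IsLeast.csInf_eq ⟨⟨fun _ => 1, fun _ => one_pos, ?_⟩, ?_⟩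
  · refine le_antisymm (one_le_iSup_ringMatrix fun _ => one_pos) ?_
    refine ciSup_le fun i => ciSup_le fun j => ?_
    rw [mul_one, div_one, ringMatrix]
    split_ifs <;> norm_num
  · rintro v ⟨d, hd, rfl⟩
    exact one_le_iSup_ringMatrix hd

/-- For the pure ring matrix `C`, `ν_C(C) = 1/n` and `ν̄(C) = 1`: the pure ring
achieves the worst-case ratio `ν̄/ν_C = n`. -/
theorem nuC_nuBar_ring (n : ℕ) [NeZero n] :
    nuC (ringMatrix n) = 1 / n ∧ nuBar (ringMatrix n) = 1 :=
  ⟨nuC_ringMatrix n, nuBar_ringMatrix n⟩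
end

section
/- Let M = [[x, 1],[1, y]] ∈ ℝ^{2×2} with 0 < x < 1 and 0 < y < 1. Then ν_C(M) = det(M)/(x + y − 2) = (1 − xy)/(2 − x − y). -/
open Matrix BigOperators

/-- The determinant of `I - Δ M` for `M = [[x, 1], [1, y]]`. -/
lemma det_one_sub_diagonal_mul (x y : ℝ) (δ : Fin 2 → ℝ) :
    (1 - Matrix.diagonal δ * !![x, 1; 1, y]).det =
      (1 - δ 0 * x) * (1 - δ 1 * y) - δ 0 * δ 1 := by
  simp [Matrix.det_fin_two]

/-- The minimal trace of a nonnegative diagonal `Δ` making `I - Δ M` singular. -/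
lemma isLeast_trace_singular {x y : ℝ} (hx0 : 0 < x) (hx1 : x < 1)
    (hy0 : 0 < y) (hy1 : y < 1) :
    IsLeast {s : ℝ | ∃ δ : Fin 2 → ℝ, (∀ i, 0 ≤ δ i) ∧
      (1 - Matrix.diagonal δ * !![x, 1; 1, y]).det = 0 ∧ s = ∑ i, δ i}
      ((2 - x - y) / (1 - x * y)) := by
  have hD : 0 < 1 - x * y := by nlinarith
  constructor
  · refine ⟨![(1 - y) / (1 - x * y), (1 - x) / (1 - x * y)], ?_, ?_, ?_⟩
    · intro i
      fin_cases i
      · exact div_nonneg (by linarith) hD.le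
      · exact div_nonneg (by linarith) hD.le
    · rw [det_one_sub_diagonal_mul]
      simp only [Matrix.cons_val_zero, Matrix.cons_val_one]
      linear_combination (-(1 - x) * (1 - y) * (1 - x * y)⁻¹ - 1) * mul_inv_cancel₀ hD.ne'
    · simp only [Fin.sum_univ_two, Matrix.cons_val_zero, Matrix.cons_val_one]
      ring
  · rintro s ⟨δ, hδ, hdet, rfl⟩
    rw [det_one_sub_diagonal_mul] at hdet
    rw [Fin.sum_univ_two, div_le_iff₀ hD]
    have hu : 0 < (1 - x * y) * δ 0 + y := by nlinarith [mul_nonneg hD.le (hδ 0)]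
    have hv : 0 < (1 - x * y) * δ 1 + x := by nlinarith [mul_nonneg hD.le (hδ 1)]
    have huv : ((1 - x * y) * δ 0 + y) * ((1 - x * y) * δ 1 + x) = 1 := by
      linear_combination -(1 - x * y) * hdet
    nlinarith [sq_nonneg (((1 - x * y) * δ 0 + y) - ((1 - x * y) * δ 1 + x))]

/-- For `M = [[x, 1], [1, y]]` with `0 < x < 1` and `0 < y < 1`:
`ν_C(M) = det(M)/(x + y − 2) = (1 − xy)/(2 − x − y)`. -/
theorem nuC_two_by_two_small {x y : ℝ} (hx0 : 0 < x) (hx1 : x < 1)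
    (hy0 : 0 < y) (hy1 : y < 1) :
    nuC !![x, 1; 1, y] = (!![x, 1; 1, y]).det / (x + y - 2) ∧
    nuC !![x, 1; 1, y] = (1 - x * y) / (2 - x - y) := by
  have h : nuC !![x, 1; 1, y] = (1 - x * y) / (2 - x - y) := by
    rw [nuC, (isLeast_trace_singular hx0 hx1 hy0 hy1).csInf_eq, inv_div]
  refine ⟨?_, h⟩
  rw [h, Matrix.det_fin_two_of, ← neg_div_neg_eq]
  congr 1 <;> ring
end
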